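/- Let M, M′ be nonnegative integers, let r_1,…,r_M and r′_1,…,r′_{M′} be positive integers, let s be a nonnegative integer, and set k = s + ∑_{j=1}^M r_j + ∑_{j′=1}^{M′} r′_{j′}. Then ∑_{n=1}^∞ [∏_{j=1}^M H_{n-1}^{(r_j)}] · [∏_{j′=1}^{M′} (H_{2n-1}^{(r′_{j′})} + H̄_{2n-1}^{(r′_{j′})})] / (2n-1)^{s+2} belongs to 𝔷_{k+2}(2), and ∑_{n=1}^∞ (-1)^n [∏_{j=1}^M H_{n-1}^{(r_j)}] · [∏_{j′=1}^{M′} (H_{2n-1}^{(r′_{j′})} + H̄_{2n-1}^{(r′_{j′})})] / (2n-1)^{s+1} belongs to i · 𝔷_{k+1}(4). -/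

import Mathlib

open scoped Real
open MeasureTheory

noncomputable section

/-- Goncharov's multiple polylogarithm. -/
def MPL {n : ℕ} (a : Fin n → ℕ) (z : Fin n → ℂ) : ℂ :=
  ∑' ℓ : {f : Fin n → ℕ // StrictAnti f ∧ ∀ i, 0 < f i},
    ∏ j, z j ^ (ℓ.1 j) / ((ℓ.1 j : ℂ) ^ (a j))

/-- `x` is a (convergent) multiple polylogarithm value of weight `k` at `N`-th roots of unity. -/
def IsCMZV (k N : ℕ) (x : ℂ) : Prop :=
  ∃ (n : ℕ) (a : Fin (n + 1) → ℕ) (z : Fin (n + 1) → ℂ),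
    (∀ j, 0 < a j) ∧ (∀ j, z j ^ N = 1) ∧ (∑ j, a j = k) ∧
    ¬(a 0 = 1 ∧ z 0 = 1) ∧ x = MPL a z

/-- The ℚ-vector space `𝔷_k(N)`. -/
def zspan (k N : ℕ) : Submodule ℚ ℂ := Submodule.span ℚ {x | IsCMZV k N x}

/-- Harmonic number of order `r`: `H_n^{(r)} = ∑_{k=1}^n 1/k^r`. -/
def H (r n : ℕ) : ℝ := ∑ k ∈ Finset.range n, (1 : ℝ) / (k + 1) ^ r

/-- Alternating harmonic number of order `r`: `H̄_n^{(r)} = ∑_{k=1}^n (-1)^{k-1}/k^r`. -/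
def Hbar (r n : ℕ) : ℝ := ∑ k ∈ Finset.range n, (-1 : ℝ) ^ k / (k + 1) ^ r

open Finset in
def SS {R : Type*} [CommRing R] : (d : ℕ) → (Fin d → ℕ → R) → ℕ → R
  | 0, _, _ => 1
  | d + 1, w, n => ∑ l ∈ range n, w 0 l * SS d (fun j => w j.succ) l

lemma strictAnti_cons {d : ℕ} (l : ℕ) (g : Fin d → ℕ) :
    StrictAnti (Fin.cons l g : Fin (d + 1) → ℕ) ↔ StrictAnti g ∧ ∀ i, g i < l := by
  constructor
  · intro h
    refine ⟨fun i j hij => ?_, fun i => ?_⟩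
    · have := h (Fin.succ_lt_succ_iff.2 hij)
      simpa using this
    · have := h (Fin.succ_pos i)
      simpa using this
  · rintro ⟨h1, h2⟩ i j hij
    induction i using Fin.cases with
    | zero =>
      induction j using Fin.cases with
      | zero => exact absurd hij (lt_irrefl _)
      | succ j => simpa using h2 j
    | succ i =>
      induction j using Fin.cases with
      | zero => exact absurd hij (by simp)
      | succ j =>
        have := h1 (Fin.succ_lt_succ_iff.1 hij)
        simpa using this

open Classical in
def GG {R : Type*} [CommRing R] (d : ℕ) (w : Fin d → ℕ → R) (n : ℕ) (g : Fin d → ℕ) : R :=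
  if StrictAnti g ∧ ∀ i, g i < n then ∏ j, w j (g j) else 0

lemma summable_GG {R : Type*} [NormedCommRing R] (d : ℕ) (w : Fin d → ℕ → R) (n : ℕ) :
    Summable (GG d w n) := by
  apply summable_of_hasFiniteSupport
  have : (Set.pi Set.univ (fun _ : Fin d => Set.Iio n)).Finite :=
    Set.Finite.pi (fun _ => Set.finite_Iio n)
  refine this.subset ?_
  intro g hg
  simp only [Function.mem_support, GG] at hg
  by_cases h : StrictAnti g ∧ ∀ i, g i < n
  · intro i _; exact h.2 i
  · simp [h] at hg

lemma GG_cons {R : Type*} [CommRing R] (d : ℕ) (w : Fin (d + 1) → ℕ → R) (n l : ℕ)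
    (g : Fin d → ℕ) :
    GG (d + 1) w n (Fin.cons l g) =
      if l < n then w 0 l * GG d (fun j => w j.succ) l g else 0 := by
  simp only [GG, strictAnti_cons, Fin.forall_fin_succ, Fin.cons_zero, Fin.cons_succ,
    Fin.prod_univ_succ, mul_ite, mul_zero]
  by_cases h : l < n
  · by_cases h2 : StrictAnti g ∧ ∀ i, g i < l
    · have : ∀ i, g i < n := fun i => (h2.2 i).trans h
      simp [h, h2, this]
    · rw [if_neg (by tauto)]; simp [h2]
  · simp [h]

lemma hasSum_GG {R : Type*} [NormedCommRing R] (d : ℕ) (w : Fin d → ℕ → R) (n : ℕ) :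
    HasSum (GG d w n) (SS d w n) := by
  induction d generalizing n with
  | zero =>
    have : (GG 0 w n) = fun _ => 1 := by
      funext g
      simp [GG, Subsingleton.strictAnti]
    rw [this]
    simp [SS]
  | succ d ih =>
    have h1 := (summable_GG (d + 1) w n).hasSum
    have h2 := ((Fin.consEquiv (fun _ : Fin (d + 1) => ℕ)).hasSum_iff).2 h1
    have h3 := h2.prod_fiberwise (g := fun l => if l < n then
      w 0 l * SS d (fun j => w j.succ) l else 0) (by
        intro l
        have : (fun c => (GG (d + 1) w n ∘ ⇑(Fin.consEquiv (fun _ : Fin (d + 1) => ℕ))) (l, c)) =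
          fun g => if l < n then w 0 l * GG d (fun j => w j.succ) l g else 0 := by
          funext g
          exact GG_cons d w n l g
        rw [this]
        by_cases h : l < n
        · simp only [h, if_true]
          exact (ih _ l).mul_left _
        · simp only [h, if_false]
          exact hasSum_zero)
    have h4 : HasSum (fun l => if l < n then
      w 0 l * SS d (fun j => w j.succ) l else 0) (SS (d + 1) w n) := by
      have := hasSum_sum_of_ne_finset_zero (L := SummationFilter.unconditional ℕ) (f := fun l => if l < n then
        w 0 l * SS d (fun j => w j.succ) l else 0) (s := Finset.range n) (by
          intro b hb; simp at hb; simp [hb])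
      convert this using 1
      rw [SS]
      apply Finset.sum_congr rfl
      intro l hl
      simp [Finset.mem_range.1 hl]
    rw [← h3.unique h4]
    exact h1

/-! growth -/

lemma SS_nonneg (d : ℕ) (w : Fin d → ℕ → ℝ) (hw : ∀ j l, 0 ≤ w j l) (n : ℕ) : 0 ≤ SS d w n := by
  induction d generalizing n with
  | zero => simp [SS]
  | succ d ih =>
    rw [SS]
    exact Finset.sum_nonneg fun l _ => mul_nonneg (hw _ _) (ih _ (fun j l => hw _ _) _)

def hh (n : ℕ) : ℝ := ∑ l ∈ Finset.range n, 1 / (l : ℝ)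

lemma hh_nonneg (n : ℕ) : 0 ≤ hh n := Finset.sum_nonneg fun l _ => by positivity

lemma hh_mono {m n : ℕ} (h : m ≤ n) : hh m ≤ hh n :=
  Finset.sum_le_sum_of_subset_of_nonneg (Finset.range_mono h) fun l _ _ => by positivity

lemma SS_le (d : ℕ) (w : Fin d → ℕ → ℝ) (hw : ∀ j l, 0 ≤ w j l)
    (hw' : ∀ j l, w j l ≤ 1 / (l : ℝ)) (n : ℕ) : SS d w n ≤ hh n ^ d := by
  induction d generalizing n with
  | zero => simp [SS]
  | succ d ih =>
    rw [SS, pow_succ']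
    conv_rhs => rw [hh, Finset.sum_mul]
    refine Finset.sum_le_sum fun l hl => ?_
    refine mul_le_mul (hw' _ _) ?_ (SS_nonneg _ _ (fun j l => hw _ _) _) (by positivity)
    refine (ih _ (fun j l => hw _ _) (fun j l => hw' _ _) l).trans ?_
    exact pow_le_pow_left₀ (hh_nonneg _) (hh_mono (Finset.mem_range.1 hl).le) _

lemma hh_le (n : ℕ) : hh n ≤ 1 + Real.log n := by
  rcases n with _ | n
  · simp [hh]
  · have h := harmonic_le_one_add_log n
    have e : hh (n + 1) = (harmonic n : ℝ) := by
      rw [hh, Finset.sum_range_succ']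
      simp [harmonic]
    rw [e]
    refine h.trans ?_
    rcases n with _ | n
    · simp
    · gcongr
      simp

lemma summable_hh (d : ℕ) : Summable fun n : ℕ => 1 / (n : ℝ) ^ 2 * hh n ^ d := by
  have h0 : Summable fun n : ℕ => (n : ℝ) ^ (-(3 / 2) : ℝ) :=
    Real.summable_nat_rpow.2 (by norm_num)
  refine summable_of_isBigO_nat h0 ?_
  have h1 : (fun x : ℝ => (1 + Real.log x) ^ d) =O[Filter.atTop] fun x => x ^ (1 / 2 : ℝ) := by
    have : (fun x : ℝ => 1 + Real.log x) =O[Filter.atTop] Real.log := by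
      refine Asymptotics.IsBigO.add ?_ (Asymptotics.isBigO_refl _ _)
      exact (Real.isLittleO_const_log_atTop).isBigO
    refine (this.pow d).trans ?_
    have h2 := isLittleO_log_rpow_rpow_atTop (d : ℝ) (show (0 : ℝ) < 1 / 2 by norm_num)
    simpa using h2.isBigO
  have h2 : (fun n : ℕ => hh n ^ d) =O[Filter.atTop] fun n : ℕ => (n : ℝ) ^ (1 / 2 : ℝ) := by
    refine Asymptotics.IsBigO.trans ?_ (h1.comp_tendsto tendsto_natCast_atTop_atTop)
    refine Asymptotics.IsBigO.of_bound 1 (Filter.Eventually.of_forall fun n => ?_)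
    have := hh_nonneg n
    simp only [Function.comp, one_mul]
    rw [Real.norm_of_nonneg (by positivity), Real.norm_of_nonneg
      (pow_nonneg (this.trans (hh_le n)) _)]
    exact pow_le_pow_left₀ this (hh_le n) _
  refine ((Asymptotics.isBigO_refl (fun n : ℕ => 1 / (n : ℝ) ^ 2) Filter.atTop).mul h2).trans ?_
  refine Asymptotics.IsBigO.of_bound 1 ?_
  filter_upwards [Filter.eventually_gt_atTop 0] with n hn
  have hn' : (0 : ℝ) < n := by exact_mod_cast hn
  rw [one_mul]
  apply le_of_eq
  congr 1
  rw [one_div, ← Real.rpow_natCast, ← Real.rpow_neg hn'.le, ← Real.rpow_add hn']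
  norm_num

open Classical in
lemma hasSum_total (d : ℕ) (w : Fin (d + 1) → ℕ → ℂ) (h0 : ∀ l, ‖w 0 l‖ ≤ 1 / (l : ℝ) ^ 2)
    (hw : ∀ (j : Fin d) l, ‖w j.succ l‖ ≤ 1 / (l : ℝ)) :
    HasSum (fun l => w 0 l * SS d (fun j => w j.succ) l)
      (∑' f : Fin (d + 1) → ℕ, if StrictAnti f then ∏ j, w j (f j) else 0) := by
  have key : ∀ (l : ℕ) (g : Fin d → ℕ), (if StrictAnti (Fin.cons l g : Fin (d + 1) → ℕ) then
      ∏ j, w j ((Fin.cons l g : Fin (d + 1) → ℕ) j) else 0) =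
      w 0 l * GG d (fun j => w j.succ) l g := by
    intro l g
    simp only [GG, strictAnti_cons, Fin.cons_zero, Fin.cons_succ,
      Fin.prod_univ_succ, mul_ite, mul_zero]
  have hn : ∀ (l : ℕ) (g : Fin d → ℕ), ‖GG d (fun j => w j.succ) l g‖ =
      GG d (fun j l => ‖w j.succ l‖) l g := by
    intro l g
    simp only [GG]
    split_ifs <;> simp
  let e : ℕ × (Fin d → ℕ) ≃ (Fin (d + 1) → ℕ) := Fin.consEquiv (fun _ : Fin (d + 1) => ℕ)
  set F : (Fin (d + 1) → ℕ) → ℂ := fun f => if StrictAnti f then ∏ j, w j (f j) else 0 with hF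
  have keyF : ∀ p : ℕ × (Fin d → ℕ), (F ∘ e) p = w 0 p.1 * GG d (fun j => w j.succ) p.1 p.2 :=
    fun p => key p.1 p.2
  have hin : ∀ l, HasSum (fun g => ‖(F ∘ e) (l, g)‖)
      (‖w 0 l‖ * SS d (fun j l => ‖w j.succ l‖) l) := by
    intro l
    have h5 := (hasSum_GG d (fun j l => ‖w (Fin.succ j) l‖) l).mul_left ‖w 0 l‖
    have h6 : (fun g => ‖(F ∘ e) (l, g)‖) = fun g => ‖w 0 l‖ * GG d (fun j l => ‖w (Fin.succ j) l‖) l g := by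
      funext g
      rw [keyF, norm_mul, hn]
    rw [h6]
    exact h5
  have hs : Summable (F ∘ e) := by
    apply Summable.of_norm
    refine (summable_prod_of_nonneg (f := fun p => ‖(F ∘ e) p‖) (fun _ => norm_nonneg _)).2 ⟨fun l => (hin l).summable, ?_⟩
    simp only [fun l => (hin l).tsum_eq]
    refine Summable.of_nonneg_of_le (fun l => ?_) (fun l => ?_) (summable_hh d)
    · exact mul_nonneg (norm_nonneg _) (SS_nonneg _ _ (fun _ _ => norm_nonneg _) _)
    · exact mul_le_mul (h0 l) (SS_le _ _ (fun _ _ => norm_nonneg _) hw _)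
        (SS_nonneg _ _ (fun _ _ => norm_nonneg _) _) (by positivity)
  have hs' : HasSum (F ∘ e) (∑' f, F f) := e.hasSum_iff.2 (e.summable_iff.1 hs).hasSum
  refine hs'.prod_fiberwise fun l => ?_
  have h6 : (fun g => (F ∘ e) (l, g)) = fun g => w 0 l * GG d (fun j => w (Fin.succ j)) l g := by
    funext g
    rw [keyF]
  rw [h6]
  exact (hasSum_GG d (fun j => w (Fin.succ j)) l).mul_left (w 0 l)

def wt (a : ℕ) (z : ℂ) (l : ℕ) : ℂ := z ^ l / (l : ℂ) ^ a

lemma norm_wt {a : ℕ} {z : ℂ} (hz : ‖z‖ = 1) (l : ℕ) : ‖wt a z l‖ = 1 / (l : ℝ) ^ a := by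
  simp [wt, hz]

lemma norm_wt_le {a b : ℕ} {z : ℂ} (hz : ‖z‖ = 1) (hb : 0 < b) (h : b ≤ a) (l : ℕ) :
    ‖wt a z l‖ ≤ 1 / (l : ℝ) ^ b := by
  rw [norm_wt hz]
  rcases Nat.eq_zero_or_pos l with rfl | hl
  · rw [Nat.cast_zero, zero_pow (by omega), zero_pow (by omega)]
  · have : (1 : ℝ) ≤ l := by exact_mod_cast hl
    gcongr

lemma hasSum_MPL {d : ℕ} (a : Fin (d + 1) → ℕ) (z : Fin (d + 1) → ℂ) (ha : ∀ j, 0 < a j)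
    (h2 : 2 ≤ a 0) (hz : ∀ j, ‖z j‖ = 1) :
    HasSum (fun l => wt (a 0) (z 0) l * SS d (fun j => wt (a j.succ) (z j.succ)) l) (MPL a z) := by
  classical
  have h := hasSum_total d (fun j => wt (a j) (z j)) (fun l => norm_wt_le (hz 0) two_pos h2 l)
    (fun j l => by simpa using norm_wt_le (hz j.succ) one_pos (ha j.succ) l)
  convert h using 1
  rw [MPL]
  rw [show (∑' ℓ : {f : Fin (d + 1) → ℕ // StrictAnti f ∧ ∀ i, 0 < f i},
    ∏ j, z j ^ (ℓ.1 j) / ((ℓ.1 j : ℂ) ^ (a j))) = ∑' f, Set.indicator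
      {f : Fin (d + 1) → ℕ | StrictAnti f ∧ ∀ i, 0 < f i}
      (fun f => ∏ j, z j ^ (f j) / ((f j : ℂ) ^ (a j))) f from
      tsum_subtype {f : Fin (d + 1) → ℕ | StrictAnti f ∧ ∀ i, 0 < f i}
      (fun f => ∏ j, z j ^ (f j) / ((f j : ℂ) ^ (a j)))]
  congr 1
  funext f
  simp only [Set.indicator, Set.mem_ofPred_eq]
  by_cases hf : StrictAnti f
  · by_cases hp : ∀ i, 0 < f i
    · simp [hf, hp, wt]
    · simp only [hf, hp, and_false, if_true, if_false]
      push Not at hp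
      obtain ⟨i, hi⟩ := hp
      symm
      apply Finset.prod_eq_zero (Finset.mem_univ i)
      have : f i = 0 := by omega
      simp [wt, this, (ha i).ne']
  · simp [hf]

/-! algebra -/

def Abase (N w : ℕ) : Set (ℕ → ℂ) :=
  {f | ∃ (d : ℕ) (a : Fin d → ℕ) (z : Fin d → ℂ), (∀ j, 0 < a j) ∧ (∀ j, z j ^ N = 1) ∧
    ∑ j, a j = w ∧ f = SS d (fun j => wt (a j) (z j))}

def AA (N w : ℕ) : Submodule ℚ (ℕ → ℂ) := Submodule.span ℚ (Abase N w)

def Cbase (N w : ℕ) : Set (ℕ → ℂ) :=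
  {f | ∃ (b v : ℕ) (y : ℂ) (g : ℕ → ℂ), y ^ N = 1 ∧ b + v = w ∧ g ∈ Abase N v ∧
    f = wt b y * g}

def CC (N w : ℕ) : Submodule ℚ (ℕ → ℂ) := Submodule.span ℚ (Cbase N w)

def sop (a : ℕ) (z : ℂ) : (ℕ → ℂ) →ₗ[ℚ] (ℕ → ℂ) where
  toFun f := fun n => ∑ l ∈ Finset.range n, wt a z l * f l
  map_add' f g := by
    funext n
    simp [mul_add, Finset.sum_add_distrib]
  map_smul' c f := by
    funext n
    simp [Finset.smul_sum]

lemma sop_apply (a : ℕ) (z : ℂ) (f : ℕ → ℂ) (n : ℕ) :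
    sop a z f n = ∑ l ∈ Finset.range n, wt a z l * f l := rfl

lemma SS_succ_eq {d : ℕ} (a : Fin (d + 1) → ℕ) (z : Fin (d + 1) → ℂ) :
    SS (d + 1) (fun j => wt (a j) (z j)) =
      sop (a 0) (z 0) (SS d (fun j => wt (a j.succ) (z j.succ))) := by
  funext n
  rw [SS, sop_apply]

lemma sop_base {N w a : ℕ} {z : ℂ} (ha : 0 < a) (hz : z ^ N = 1) {f : ℕ → ℂ}
    (hf : f ∈ Abase N w) : sop a z f ∈ Abase N (a + w) := by
  obtain ⟨d, a', z', h1, h2, h3, rfl⟩ := hf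
  refine ⟨d + 1, Fin.cons a a', Fin.cons z z', ?_, ?_, ?_, ?_⟩
  · intro j; induction j using Fin.cases <;> simp [ha, h1]
  · intro j; induction j using Fin.cases <;> simp [hz, h2]
  · simp [Fin.sum_univ_succ, h3]
  · rw [SS_succ_eq]; simp

lemma sop_mem {N w a : ℕ} {z : ℂ} (ha : 0 < a) (hz : z ^ N = 1) {f : ℕ → ℂ}
    (hf : f ∈ AA N w) : sop a z f ∈ AA N (a + w) := by
  have : AA N w ≤ (AA N (a + w)).comap (sop a z) := by
    refine Submodule.span_le.2 fun g hg => ?_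
    exact Submodule.subset_span (sop_base ha hz hg)
  exact this hf

def S1 (r : ℕ) (y : ℂ) : ℕ → ℂ := sop r y 1

lemma S1_apply (r : ℕ) (y : ℂ) (n : ℕ) : S1 r y n = ∑ l ∈ Finset.range n, wt r y l := by
  simp [S1, sop_apply]

lemma one_base (N : ℕ) : (1 : ℕ → ℂ) ∈ Abase N 0 :=
  ⟨0, Fin.elim0, Fin.elim0, fun j => j.elim0, fun j => j.elim0, by simp, by funext n; simp [SS]⟩

lemma sop_mul (r a : ℕ) (y z : ℂ) (f : ℕ → ℂ) :
    S1 r y * sop a z f = sop r y (sop a z f) + sop a z (S1 r y * f) + sop (r + a) (y * z) f := by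
  funext n
  simp only [Pi.mul_apply, Pi.add_apply]
  induction n with
  | zero => simp [S1_apply, sop_apply]
  | succ n ih =>
    have e1 : S1 r y (n + 1) = S1 r y n + wt r y n := by
      simp [S1_apply, Finset.sum_range_succ]
    have e2 : ∀ b x g, sop b x g (n + 1) = sop b x g n + wt b x n * g n := by
      intro b x g
      simp [sop_apply, Finset.sum_range_succ]
    have e3 : wt (r + a) (y * z) n = wt r y n * wt a z n := by
      simp only [wt, mul_pow, pow_add]
      rw [div_mul_div_comm]
    rw [e1, e2, e2, e2, e2, e3, Pi.mul_apply]
    linear_combination ih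

lemma S1_mul_base {N r : ℕ} {y : ℂ} (hr : 0 < r) (hy : y ^ N = 1) (d : ℕ) :
    ∀ (a : Fin d → ℕ) (z : Fin d → ℂ), (∀ j, 0 < a j) → (∀ j, z j ^ N = 1) →
    S1 r y * SS d (fun j => wt (a j) (z j)) ∈ AA N (r + ∑ j, a j) := by
  induction d with
  | zero =>
    intro a z _ _
    have : (SS 0 (fun j => wt (a j) (z j))) = (1 : ℕ → ℂ) := by funext n; simp [SS]
    rw [this, mul_one]
    have := Submodule.subset_span (R := ℚ) (sop_base hr hy (one_base N))
    simpa [S1, AA] using this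
  | succ d ih =>
    intro a z ha hz
    have hb : (SS d (fun j => wt (a j.succ) (z j.succ))) ∈ AA N (∑ j : Fin d, a j.succ) :=
      Submodule.subset_span ⟨d, _, _, fun j => ha _, fun j => hz _, rfl, rfl⟩
    rw [SS_succ_eq, sop_mul, Fin.sum_univ_succ]
    refine Submodule.add_mem _ (Submodule.add_mem _ ?_ ?_) ?_
    · exact sop_mem hr hy (sop_mem (ha 0) (hz 0) hb)
    · have := sop_mem (ha 0) (hz 0) (ih (fun j => a j.succ) (fun j => z j.succ)
        (fun j => ha _) (fun j => hz _))
      rwa [add_left_comm] at this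
    · have := sop_mem (a := r + a 0) (z := y * z 0) (by omega)
        (by rw [mul_pow, hy, hz, one_mul]) hb
      rwa [add_assoc] at this

def mulop (h : ℕ → ℂ) : (ℕ → ℂ) →ₗ[ℚ] (ℕ → ℂ) := LinearMap.mulLeft ℚ h

def Mult (N r : ℕ) (h : ℕ → ℂ) : Prop := ∀ w, ∀ f ∈ CC N w, h * f ∈ CC N (r + w)

lemma mult_of_base {N r : ℕ} {h : ℕ → ℂ} (H : ∀ w, ∀ f ∈ Cbase N w, h * f ∈ CC N (r + w)) :
    Mult N r h := by
  intro w f hf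
  have : CC N w ≤ (CC N (r + w)).comap (LinearMap.mulLeft ℚ h) :=
    Submodule.span_le.2 fun g hg => H w g hg
  exact this hf

lemma mult_wt {N : ℕ} (r : ℕ) {y : ℂ} (hy : y ^ N = 1) : Mult N r (wt r y) := by
  refine mult_of_base fun w f hf => ?_
  obtain ⟨b, v, y', g, h1, h2, h3, rfl⟩ := hf
  refine Submodule.subset_span ⟨r + b, v, y * y', g, by rw [mul_pow, hy, h1, one_mul],
    by omega, h3, ?_⟩
  funext n
  simp only [Pi.mul_apply, wt, mul_pow, pow_add, ← mul_assoc]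
  rw [div_mul_div_comm]

lemma mult_S1 {N r : ℕ} {y : ℂ} (hr : 0 < r) (hy : y ^ N = 1) : Mult N r (S1 r y) := by
  refine mult_of_base fun w f hf => ?_
  obtain ⟨b, v, y', g, h1, h2, h3, rfl⟩ := hf
  obtain ⟨d, a, z, ha, hz, hv, rfl⟩ := h3
  have h := S1_mul_base hr hy d a z ha hz
  have : AA N (r + ∑ j, a j) ≤ (CC N (r + w)).comap (LinearMap.mulLeft ℚ (wt b y')) :=
    Submodule.span_le.2 fun g hg => Submodule.subset_span ⟨b, _, y', g, h1, by omega, hg, rfl⟩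
  have h' := this h
  rw [mul_left_comm]
  exact h'

lemma Mult.add {N r : ℕ} {h g : ℕ → ℂ} (hh : Mult N r h) (hg : Mult N r g) :
    Mult N r (h + g) := fun w f hf => by
  rw [add_mul]; exact Submodule.add_mem _ (hh w f hf) (hg w f hf)

lemma Mult.smul {N r : ℕ} {h : ℕ → ℂ} (c : ℚ) (hh : Mult N r h) :
    Mult N r (c • h) := fun w f hf => by
  rw [smul_mul_assoc]; exact Submodule.smul_mem _ _ (hh w f hf)

lemma Mult.mul {N r r' : ℕ} {h g : ℕ → ℂ} (hh : Mult N r h) (hg : Mult N r' g) :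
    Mult N (r + r') (h * g) := fun w f hf => by
  rw [mul_assoc, add_assoc]; exact hh _ _ (hg w f hf)

lemma mult_one (N : ℕ) : Mult N 0 1 := fun w f hf => by simpa using hf

lemma mult_prod {N : ℕ} {ι : Type*} (s : Finset ι) (r : ι → ℕ) (h : ι → ℕ → ℂ)
    (H : ∀ i, Mult N (r i) (h i)) : Mult N (∑ i ∈ s, r i) (∏ i ∈ s, h i) := by
  classical
  induction s using Finset.induction_on with
  | empty => simpa using mult_one N
  | insert i s hi ih =>
    rw [Finset.sum_insert hi, Finset.prod_insert hi]
    exact (H i).mul ih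

lemma one_CC (N : ℕ) : (1 : ℕ → ℂ) ∈ CC N 0 :=
  Submodule.subset_span ⟨0, 0, 1, 1, one_pow _, rfl, one_base N, by funext n; simp [wt]⟩

lemma CC_tsum {N w a : ℕ} (hN : N ≠ 0) (ha : 2 ≤ a) {f : ℕ → ℂ} (hf : f ∈ CC N w) :
    Summable (fun l => wt a 1 l * f l) ∧ ∑' l, wt a 1 l * f l ∈ zspan (a + w) N := by
  induction hf using Submodule.span_induction with
  | zero => simp [summable_zero]
  | add f g _ _ hf hg =>
    simp only [Pi.add_apply, mul_add]
    exact ⟨hf.1.add hg.1, by rw [hf.1.tsum_add hg.1]; exact Submodule.add_mem _ hf.2 hg.2⟩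
  | smul c f _ hf =>
    simp only [Pi.smul_apply, mul_smul_comm]
    refine ⟨hf.1.const_smul c, ?_⟩
    have : HasSum (fun l => c • (wt a 1 l * f l)) (c • ∑' l, wt a 1 l * f l) :=
      hf.1.hasSum.const_smul c
    rw [this.tsum_eq]
    exact Submodule.smul_mem _ _ hf.2
  | mem f hf =>
    obtain ⟨b, v, y, g, h1, h2, h3, rfl⟩ := hf
    obtain ⟨d, a', z, ha', hz, hv, rfl⟩ := h3
    have hA : ∀ j, 0 < (Fin.cons (a + b) a' : Fin (d + 1) → ℕ) j := by
      intro j; induction j using Fin.cases with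
      | zero => simp; omega
      | succ j => simp [ha']
    have hZ : ∀ j, (Fin.cons y z : Fin (d + 1) → ℂ) j ^ N = 1 := by
      intro j; induction j using Fin.cases <;> simp [h1, hz]
    have h := hasSum_MPL (Fin.cons (a + b) a' : Fin (d + 1) → ℕ)
      (Fin.cons y z : Fin (d + 1) → ℂ) hA (by simp; omega)
      (fun j => Complex.norm_eq_one_of_pow_eq_one (hZ j) hN)
    have e : (fun l => wt a 1 l * (wt b y * SS d (fun j => wt (a' j) (z j))) l) = fun l =>
      wt ((Fin.cons (a + b) a' : Fin (d + 1) → ℕ) 0) ((Fin.cons y z : Fin (d + 1) → ℂ) 0) l *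
      SS d (fun j => wt ((Fin.cons (a + b) a' : Fin (d + 1) → ℕ) j.succ)
        ((Fin.cons y z : Fin (d + 1) → ℂ) j.succ)) l := by
      funext l
      simp only [Pi.mul_apply, Fin.cons_zero, Fin.cons_succ, ← mul_assoc]
      congr 1
      simp only [wt, pow_add, one_pow]
      rw [div_mul_div_comm, one_mul]
    rw [e]
    refine ⟨h.summable, ?_⟩
    rw [h.tsum_eq]
    refine Submodule.subset_span ⟨d, _, _, hA, hZ, ?_, ?_, rfl⟩
    · simp [Fin.sum_univ_succ]; omega
    · simp; omega

/-! specific multipliers -/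

def hE (r : ℕ) : ℕ → ℂ := ((2 : ℚ) ^ r / 2) • (S1 r 1 + S1 r (-1))

def hO (r : ℕ) : ℕ → ℂ := (S1 r 1 + (-1 : ℚ) • S1 r (-1)) + (wt r 1 + (-1 : ℚ) • wt r (-1))

def hodd : ℕ → ℂ := (1 / 2 : ℚ) • (wt 0 1 + (-1 : ℚ) • wt 0 (-1))

lemma mult_hE {N r : ℕ} (hN : Even N) (hr : 0 < r) : Mult N r (hE r) :=
  ((mult_S1 hr (one_pow _)).add (mult_S1 hr hN.neg_one_pow)).smul _

lemma mult_hO {N r : ℕ} (hN : Even N) (hr : 0 < r) : Mult N r (hO r) :=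
  ((mult_S1 hr (one_pow _)).add ((mult_S1 hr hN.neg_one_pow).smul _)).add
    ((mult_wt r (one_pow _)).add ((mult_wt r hN.neg_one_pow).smul _))

lemma mult_hodd {N : ℕ} (hN : Even N) : Mult N 0 hodd :=
  ((mult_wt 0 (one_pow _)).add ((mult_wt 0 hN.neg_one_pow).smul _)).smul _

lemma hE_apply (r n : ℕ) (hr : 0 < r) : hE r (2 * n + 1) = (H r n : ℂ) := by
  induction n with
  | zero => simp [hE, S1_apply, H, wt, hr.ne']
  | succ n ih =>
    have e1 : (H r (n + 1) : ℂ) = H r n + 1 / ((n : ℂ) + 1) ^ r := by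
      simp [H, Finset.sum_range_succ]
    rw [e1, ← ih, show 2 * (n + 1) + 1 = 2 * n + 1 + 1 + 1 by ring]
    simp only [hE, S1_apply, Finset.sum_range_succ _ (2 * n + 1 + 1),
      Finset.sum_range_succ _ (2 * n + 1), Pi.smul_apply, Pi.add_apply, Rat.smul_def, wt]
    have hp : ((-1 : ℂ)) ^ (2 * n) = 1 := by simp
    simp only [pow_succ _ (2 * n + 1), pow_succ _ (2 * n), hp, one_pow]
    have hc : (((2 * n + 1 + 1 : ℕ) : ℂ)) ^ r = 2 ^ r * ((n : ℂ) + 1) ^ r := by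
      rw [← mul_pow]; congr 1; push_cast; ring
    rw [hc]
    have h0 : ((n : ℂ) + 1) ^ r ≠ 0 := pow_ne_zero _ (by exact_mod_cast n.succ_ne_zero)
    push_cast
    field_simp
    ring

lemma hO_apply (r n : ℕ) (hr : 0 < r) :
    hO r (2 * n + 1) = (H r (2 * n + 1) : ℂ) + (Hbar r (2 * n + 1) : ℂ) := by
  have e : ∀ m, hO r m = S1 r 1 (m + 1) - S1 r (-1) (m + 1) := by
    intro m
    simp [hO, S1_apply, Finset.sum_range_succ]
    ring
  rw [e]
  generalize 2 * n + 1 = m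
  simp only [S1_apply, Finset.sum_range_succ']
  simp [H, Hbar, wt, hr.ne', pow_succ, neg_div]

lemma hodd_odd (n : ℕ) : hodd (2 * n + 1) = 1 := by
  simp [hodd, wt, pow_succ]; norm_num

lemma hodd_even (n : ℕ) : hodd (2 * n) = 0 := by
  simp [hodd, wt]

lemma tsum_odd (f : ℕ → ℂ) (h : ∀ n, f (2 * n) = 0) : ∑' n, f (2 * n + 1) = ∑' n, f n := by
  refine Function.Injective.tsum_eq (g := fun n => 2 * n + 1) (fun a b h => by simpa using h) ?_
  intro m hm
  rcases Nat.even_or_odd' m with ⟨k, rfl | rfl⟩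
  · exact absurd (h k) hm
  · exact ⟨k, rfl⟩

lemma main_sum {N M M' : ℕ} (hN : Even N) (hN0 : N ≠ 0) (r : Fin M → ℕ) (hr : ∀ j, 0 < r j)
    (r' : Fin M' → ℕ) (hr' : ∀ j, 0 < r' j) (s : ℕ) {y : ℂ} (hy : y ^ N = 1) :
    ∑' n : ℕ, y ^ (2 * n + 1) * ((∏ j, (H (r j) n : ℂ)) *
        (∏ j', ((H (r' j') (2 * n + 1) : ℂ) + (Hbar (r' j') (2 * n + 1) : ℂ)))) /
        (2 * (n : ℂ) + 1) ^ (s + 2) ∈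
      zspan (s + (∑ j, r j) + (∑ j', r' j') + 2) N := by
  have hm := ((mult_hodd hN).mul (mult_wt 0 hy)).mul
    ((mult_prod Finset.univ r (fun j => hE (r j)) (fun j => mult_hE hN (hr j))).mul
    (mult_prod Finset.univ r' (fun j => hO (r' j)) (fun j => mult_hO hN (hr' j))))
  have h := (CC_tsum hN0 (show 2 ≤ s + 2 by omega) (hm 0 1 (one_CC N))).2
  rw [← tsum_odd _ (by intro n; simp [hodd_even])] at h
  have e2 : s + 2 + (0 + 0 + (∑ j, r j + ∑ j', r' j') + 0) =
    s + (∑ j, r j) + (∑ j', r' j') + 2 := by ring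
  rw [e2] at h
  convert h using 3 with n
  simp only [Pi.mul_apply, Finset.prod_apply, hodd_odd, hE_apply _ _ (hr _), hO_apply _ _ (hr' _),
    wt, Pi.one_apply]
  push_cast
  simp
  ring

lemma H_ge {r n : ℕ} : 1 ≤ H r (n + 1) := by
  rw [H, Finset.sum_range_succ']
  have : 0 ≤ ∑ k ∈ Finset.range n, (1 : ℝ) / ((k + 1 : ℕ) + 1 : ℝ) ^ r :=
    Finset.sum_nonneg fun k _ => by positivity
  simp at this ⊢
  exact this

lemma HH_ge {r n : ℕ} : 1 ≤ H r (n + 1) + Hbar r (n + 1) := by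
  rw [H, Hbar, ← Finset.sum_add_distrib, Finset.sum_range_succ']
  have : 0 ≤ ∑ k ∈ Finset.range n, ((1 : ℝ) / ((k + 1 : ℕ) + 1 : ℝ) ^ r +
    (-1) ^ (k + 1) / ((k + 1 : ℕ) + 1 : ℝ) ^ r) := by
    refine Finset.sum_nonneg fun k _ => ?_
    rw [← add_div]
    refine div_nonneg ?_ (by positivity)
    rcases neg_one_pow_eq_or ℝ (k + 1) with h | h <;> rw [h] <;> norm_num
  refine le_trans ?_ (add_le_add_left this _)
  norm_num

lemma one_le_prod_real {M : ℕ} (f : Fin M → ℝ) (h : ∀ j, 1 ≤ f j) : 1 ≤ ∏ j, f j := by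
  have := Finset.prod_le_prod (s := Finset.univ) (f := fun _ : Fin M => (1 : ℝ)) (g := f)
    (fun _ _ => zero_le_one) (fun j _ => h j)
  simpa using this

lemma not_summable_aux {M M' : ℕ} (r : Fin M → ℕ) (r' : Fin M' → ℕ) :
    ¬ Summable (fun n : ℕ => (-1 : ℂ) ^ (n + 1) * (∏ j, (H (r j) n : ℂ)) *
        (∏ j', ((H (r' j') (2 * n + 1) : ℂ) + (Hbar (r' j') (2 * n + 1) : ℂ))) /
        (2 * (n : ℂ) + 1) ^ (0 + 1)) := by
  intro h
  have h1 := ((summable_nat_add_iff 1).2 h).norm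
  have h2 : Summable fun n : ℕ => (1 / 3 : ℝ) * (1 / ((n + 1 : ℕ) : ℝ)) := by
    refine Summable.of_nonneg_of_le (fun n => by positivity) (fun n => ?_) h1
    have p1 : 1 ≤ ‖∏ j, (H (r j) (n + 1) : ℂ)‖ := by
      rw [norm_prod]
      refine one_le_prod_real _ fun j => ?_
      rw [Complex.norm_real]
      exact H_ge.trans (le_abs_self _)
    have p2 : 1 ≤ ‖∏ j', ((H (r' j') (2 * (n + 1) + 1) : ℂ) +
        (Hbar (r' j') (2 * (n + 1) + 1) : ℂ))‖ := by
      rw [norm_prod]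
      refine one_le_prod_real _ fun j => ?_
      rw [← Complex.ofReal_add, Complex.norm_real]
      exact HH_ge.trans (le_abs_self _)
    have p3 : ‖(2 * ((n + 1 : ℕ) : ℂ) + 1)‖ = 2 * (n + 1) + 1 := by
      rw [show (2 * ((n + 1 : ℕ) : ℂ) + 1) = ((2 * (n + 1) + 1 : ℝ) : ℂ) by push_cast; ring,
        Complex.norm_real, Real.norm_of_nonneg (by positivity)]
    rw [norm_div, norm_mul, norm_mul, norm_pow, norm_pow, p3, norm_neg, norm_one, one_pow, one_mul,
      zero_add, pow_one]
    calc (1 / 3 : ℝ) * (1 / ((n + 1 : ℕ) : ℝ)) ≤ 1 / (2 * (n + 1) + 1) := by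
          push_cast
          rw [one_div_mul_one_div]
          apply one_div_le_one_div_of_le (by positivity)
          have : (0 : ℝ) ≤ n := n.cast_nonneg
          linarith
      _ ≤ _ := by
          gcongr
          exact one_le_mul_of_one_le_of_one_le p1 p2
  have h3 := (summable_mul_left_iff (by norm_num)).1 h2
  exact Real.not_summable_one_div_natCast ((summable_nat_add_iff 1).1 h3)

/-- Odd-variable Euler sums: for nonnegative `M, M′, s`, positive `r_j, r′_{j′}`,
`k = s + ∑ r_j + ∑ r′_{j′}`,
`∑_{n=1}^∞ (∏_j H_{n-1}^{(r_j)}) (∏_{j′} (H_{2n-1}^{(r′_{j′})} + H̄_{2n-1}^{(r′_{j′})}))/(2n-1)^{s+2}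
  ∈ 𝔷_{k+2}(2)` and the alternating version with `(-1)^n/(2n-1)^{s+1}` lies in `i·𝔷_{k+1}(4)`. -/
theorem odd_euler_sums (M M' : ℕ) (r : Fin M → ℕ) (hr : ∀ j, 0 < r j)
    (r' : Fin M' → ℕ) (hr' : ∀ j, 0 < r' j) (s : ℕ) :
    (∑' n : ℕ, (∏ j, (H (r j) n : ℂ)) *
        (∏ j', ((H (r' j') (2 * n + 1) : ℂ) + (Hbar (r' j') (2 * n + 1) : ℂ))) /
        (2 * (n : ℂ) + 1) ^ (s + 2) ∈
      zspan (s + (∑ j, r j) + (∑ j', r' j') + 2) 2) ∧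
    (∃ c ∈ zspan (s + (∑ j, r j) + (∑ j', r' j') + 1) 4,
      ∑' n : ℕ, (-1 : ℂ) ^ (n + 1) * (∏ j, (H (r j) n : ℂ)) *
        (∏ j', ((H (r' j') (2 * n + 1) : ℂ) + (Hbar (r' j') (2 * n + 1) : ℂ))) /
        (2 * (n : ℂ) + 1) ^ (s + 1) = Complex.I * c) := by
  refine ⟨?_, ?_⟩
  · have h := main_sum (N := 2) even_two two_ne_zero r hr r' hr' s (one_pow 2)
    simpa only [one_pow, one_mul] using h
  · rcases s with _ | s
    · refine ⟨0, Submodule.zero_mem _, ?_⟩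
      rw [tsum_eq_zero_of_not_summable (not_summable_aux r r'), mul_zero]
    · have h := main_sum (N := 4) (by decide) (by norm_num) r hr r' hr' s Complex.I_pow_four
      refine ⟨_, by convert h using 2; ring, ?_⟩
      rw [← tsum_mul_left]
      refine tsum_congr fun n => ?_
      have : (-1 : ℂ) ^ (n + 1) = Complex.I * Complex.I ^ (2 * n + 1) := by
        rw [← pow_succ', show 2 * n + 1 + 1 = 2 * (n + 1) by ring, pow_mul, Complex.I_sq]
      rw [this]
      ring
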